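/- A trapezoidal word w over {a,b} is strictly bispecial (i.e., awa, awb, bwa, bwb are all trapezoidal) if and only if w is central or semicentral. -/

import Mathlib

/-- The two-letter alphabet {a, b}. -/
inductive AB : Type
  | a : AB
  | b : AB
deriving DecidableEq, Repr

/-- A (finite) word over {a, b}. -/
abbrev Word := List AB

open AB

/-- `u` occurs in `w` at position `i`. -/
def OccursAt (u w : Word) (i : ℕ) : Prop :=
  i + u.length ≤ w.length ∧ (w.drop i).take u.length = u

/-- `u` occurs exactly once in `w` (is unrepeated in `w`). -/
def OccursOnce (u w : Word) : Prop := ∃! i, OccursAt u w i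

/-- `u` is a right special factor of `w`: both `ua` and `ub` are factors of `w`. -/
def IsRightSpecial (u w : Word) : Prop := (u ++ [a]) <:+: w ∧ (u ++ [b]) <:+: w

/-- `u` is a left special factor of `w`: both `au` and `bu` are factors of `w`. -/
def IsLeftSpecial (u w : Word) : Prop := ([a] ++ u) <:+: w ∧ ([b] ++ u) <:+: w

/-- `K w`: the length of the shortest unrepeated suffix of `w`. -/
noncomputable def Kp (w : Word) : ℕ := sInf {n | ∃ s : Word, s <:+ w ∧ s.length = n ∧ OccursOnce s w}

/-- `H w`: the length of the shortest unrepeated prefix of `w`. -/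
noncomputable def Hp (w : Word) : ℕ := sInf {n | ∃ p : Word, p <+: w ∧ p.length = n ∧ OccursOnce p w}

/-- `R w`: the smallest `n ≥ 0` such that `w` has no right special factor of length `n`. -/
noncomputable def Rp (w : Word) : ℕ := sInf {n | ∀ u : Word, u.length = n → ¬ IsRightSpecial u w}

/-- `L w`: the smallest `n ≥ 0` such that `w` has no left special factor of length `n`. -/
noncomputable def Lp (w : Word) : ℕ := sInf {n | ∀ u : Word, u.length = n → ¬ IsLeftSpecial u w}

/-- A word `w` is trapezoidal if `|w| = K w + R w`. -/
def IsTrapezoidal (w : Word) : Prop := w.length = Kp w + Rp w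

/-- A finite word over `{a,b}` is Sturmian iff it is balanced: there is no word `u`
with both `aua` and `bub` factors of `w`. -/
def IsSturmian (w : Word) : Prop :=
  ¬ ∃ u : Word, ([a] ++ u ++ [a]) <:+: w ∧ ([b] ++ u ++ [b]) <:+: w

/-- A nonempty word is closed if it has a border (a proper prefix which is also a suffix)
whose only occurrences in `w` are as a prefix and as a suffix. -/
def IsClosedWord (w : Word) : Prop :=
  w ≠ [] ∧ ∃ v : Word, v <+: w ∧ v.length < w.length ∧ v <:+ w ∧
    ∀ i : ℕ, OccursAt v w i → i = 0 ∨ i + v.length = w.length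

/-- A nonempty word is open if it is not closed. -/
def IsOpenWord (w : Word) : Prop := w ≠ [] ∧ ¬ IsClosedWord w

/-- Central words: `a^n`, `b^n`, or `u a b v = v b a u`. -/
def IsCentral (w : Word) : Prop :=
  (∃ n : ℕ, w = List.replicate n a) ∨ (∃ n : ℕ, w = List.replicate n b) ∨
  (∃ u v : Word, w = u ++ [a, b] ++ v ∧ w = v ++ [b, a] ++ u)

/-- The minimal period of `w`: `|w|` minus the length of the longest border of `w`. -/
noncomputable def minPeriod (w : Word) : ℕ :=
  w.length - sSup {n | ∃ v : Word, v.length = n ∧ v <+: w ∧ v ≠ w ∧ v <:+ w}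

/-- A word is semicentral if it is of the form `u x y u` for a central word `u`
and distinct letters `x, y`. -/
def IsSemicentral (w : Word) : Prop :=
  ∃ (u : Word) (x y : AB), x ≠ y ∧ IsCentral u ∧ w = u ++ [x] ++ [y] ++ u

theorem AB.eq_of_ne_of_ne {x y z : AB} (hx : x ≠ z) (hy : y ≠ z) : x = y := by
  cases x <;> cases y <;> cases z <;> simp_all

/-- `w` contains all four words `s z t`, with `s` and `t` letters, for some word `z`. -/
def HasFullExtension (w : Word) : Prop := ∃ z : Word, ∀ s t : AB, s :: (z ++ [t]) <:+: w

/-! ### Counting right special factors -/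

/-- The suffixes of `w` that have another occurrence in `w`. -/
def repeatedSuffixes (w : Word) : Set Word := {s | s <:+ w ∧ ∃ y, s ++ [y] <:+: w}

/-- The right special factors of `w`. -/
def rightSpecials (w : Word) : Set Word := {u | IsRightSpecial u w}

theorem mem_rightSpecials_iff {u w : Word} :
    u ∈ rightSpecials w ↔ ∀ y, u ++ [y] <:+: w :=
  ⟨fun h y => by cases y; exacts [h.1, h.2], fun h => ⟨h a, h b⟩⟩

theorem finite_suffixes (w : Word) : {s : Word | s <:+ w}.Finite := by
  refine (w.tails.toFinset.finite_toSet).subset fun s hs => ?_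
  simpa using hs

theorem finite_infixes (w : Word) : {s : Word | s <:+: w}.Finite := by
  induction w with
  | nil => simp
  | cons c w ih =>
    refine (((c :: w).inits.toFinset.finite_toSet).union ih).subset fun s hs => ?_
    rcases List.infix_cons_iff.1 hs with h | h
    · left
      simp only [List.coe_toFinset, Set.mem_ofPred_eq]
      exact (List.mem_inits _ _).2 h
    · exact Or.inr h

theorem finite_repeatedSuffixes (w : Word) : (repeatedSuffixes w).Finite :=
  (finite_suffixes w).subset fun _ hs => hs.1

theorem finite_rightSpecials (w : Word) : (rightSpecials w).Finite :=
  (finite_infixes w).subset fun u hu => (List.prefix_append u [a]).isInfix.trans hu.1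

theorem append_singleton_infix_concat {u w : Word} {x y : AB} :
    u ++ [y] <:+: w ++ [x] ↔ u ++ [y] <:+: w ∨ (y = x ∧ u <:+ w) := by
  rw [List.infix_concat_iff]
  constructor
  · rintro (h | h)
    · right
      rw [List.suffix_concat_iff] at h
      rcases h with h | ⟨t, h, h'⟩
      · simp at h
      · obtain ⟨rfl, h2⟩ := List.append_inj' h rfl
        simp at h2
        exact ⟨h2, h'⟩
    · exact Or.inl h
  · rintro (h | ⟨rfl, h⟩)
    · exact Or.inr h
    · left
      obtain ⟨t, rfl⟩ := h
      exact ⟨t, by simp⟩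

theorem exists_append_singleton_infix_concat {u w : Word} {x : AB} (h : u <:+: w) :
    ∃ y, u ++ [y] <:+: w ++ [x] := by
  obtain ⟨s, t, rfl⟩ := h
  cases t with
  | nil => exact ⟨x, s, [], by simp⟩
  | cons d t => exact ⟨d, s, t ++ [x], by simp⟩

theorem ncard_rightSpecials_add_ncard_repeatedSuffixes (w : Word) :
    (rightSpecials w).ncard + (repeatedSuffixes w).ncard = w.length := by
  induction w using List.reverseRecOn with
  | nil =>
    have h1 : rightSpecials [] = ∅ := by
      ext u; simp [rightSpecials, IsRightSpecial]
    have h2 : repeatedSuffixes [] = ∅ := by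
      ext u; simp [repeatedSuffixes]
    simp [h1, h2]
  | append_singleton w x ih =>
    set N : Set Word := {u | u ∈ repeatedSuffixes w ∧ ¬ u ++ [x] <:+: w} with hN
    set A : Set Word := {u | u <:+ w ∧ u ++ [x] <:+: w} with hA
    have hNfin : N.Finite := (finite_repeatedSuffixes w).subset fun _ h => h.1
    have hAfin : A.Finite := (finite_suffixes w).subset fun _ h => h.1
    have hM : repeatedSuffixes w = N ∪ A := by
      ext u
      simp only [hN, hA, repeatedSuffixes, Set.mem_union, Set.mem_ofPred_eq]
      constructor
      · rintro ⟨h, y, hy⟩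
        by_cases hx : u ++ [x] <:+: w
        · exact Or.inr ⟨h, hx⟩
        · exact Or.inl ⟨⟨h, y, hy⟩, hx⟩
      · rintro (h | h)
        · exact h.1
        · exact ⟨h.1, x, h.2⟩
    have hR : rightSpecials (w ++ [x]) = rightSpecials w ∪ N := by
      ext u
      simp only [hN, repeatedSuffixes, Set.mem_union, Set.mem_ofPred_eq, mem_rightSpecials_iff,
        append_singleton_infix_concat]
      constructor
      · intro h
        by_cases hx : u ++ [x] <:+: w
        · left
          intro y
          rcases h y with h | ⟨rfl, -⟩
          · exact h
          · exact hx
        · right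
          obtain ⟨y, hy⟩ : ∃ y : AB, y ≠ x := by cases x; exacts [⟨b, by simp⟩, ⟨a, by simp⟩]
          refine ⟨⟨((h x).resolve_left hx).2, y, (h y).resolve_right fun h => hy h.1⟩, hx⟩
      · rintro (h | ⟨⟨h, y, hy⟩, hx⟩) z
        · exact Or.inl (h z)
        · by_cases hz : z = x
          · exact Or.inr ⟨hz, h⟩
          · have hyx : y ≠ x := by rintro rfl; exact hx hy
            rw [AB.eq_of_ne_of_ne hz hyx]
            exact Or.inl hy
    have hM' : repeatedSuffixes (w ++ [x]) = insert [] ((fun u => u ++ [x]) '' A) := by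
      ext u
      simp only [hA, repeatedSuffixes, Set.mem_insert_iff, Set.mem_image, Set.mem_ofPred_eq]
      constructor
      · rintro ⟨h, y, hy⟩
        rw [List.suffix_concat_iff] at h
        rcases h with h | ⟨t, rfl, h⟩
        · exact Or.inl h
        · refine Or.inr ⟨t, ⟨h, ?_⟩, rfl⟩
          rcases append_singleton_infix_concat.1 hy with h | h
          · exact (List.prefix_append _ _).isInfix.trans h
          · exact h.2.isInfix
      · rintro (rfl | ⟨t, ⟨h, h'⟩, rfl⟩)
        · exact ⟨List.nil_suffix, x, w, [], by simp⟩
        · refine ⟨?_, exists_append_singleton_infix_concat h'⟩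
          obtain ⟨r, rfl⟩ := h
          exact ⟨r, by simp⟩
    have hdisj : Disjoint N A := Set.disjoint_left.2 fun u h h' => h.2 h'.2
    have hdisj' : Disjoint (rightSpecials w) N :=
      Set.disjoint_left.2 fun u h h' => h'.2 (mem_rightSpecials_iff.1 h x)
    have hinj : Function.Injective (fun u : Word => u ++ [x]) := List.append_left_injective [x]
    rw [hM, Set.ncard_union_eq hdisj hNfin hAfin] at ih
    rw [hR, hM', Set.ncard_union_eq hdisj' (finite_rightSpecials w) hNfin,
      Set.ncard_insert_of_notMem (by simp) (hAfin.image _), Set.ncard_image_of_injective _ hinj]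
    simp only [List.length_append, List.length_singleton]
    omega

theorem length_image_eq_Iio {X : Set Word} (hX : ∀ s ∈ X, ∀ t, t <:+ s → t ∈ X) {k : ℕ}
    (hlt : ∀ n < k, ∃ u ∈ X, u.length = n) (hk : ∀ u ∈ X, u.length ≠ k) :
    List.length '' X = Set.Iio k := by
  ext n
  simp only [Set.mem_image, Set.mem_Iio]
  refine ⟨?_, hlt n⟩
  rintro ⟨u, hu, rfl⟩
  by_contra h
  exact hk _ (hX u hu _ (List.drop_suffix (u.length - k) u)) (by simp; omega)

theorem length_image_rightSpecials (w : Word) :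
    List.length '' rightSpecials w = Set.Iio (Rp w) := by
  have hne : {n | ∀ u : Word, u.length = n → ¬ IsRightSpecial u w}.Nonempty := by
    refine ⟨w.length, fun u hu h => ?_⟩
    have := h.1.length_le
    simp at this
    omega
  refine length_image_eq_Iio ?_ ?_ ?_
  · rintro s hs t ⟨r, rfl⟩
    rw [mem_rightSpecials_iff] at hs ⊢
    intro y
    exact List.IsInfix.trans ⟨r, [], by simp⟩ (hs y)
  · intro n hn
    have := Nat.notMem_of_lt_sInf hn
    simp only [Set.mem_ofPred_eq, not_forall, not_not] at this
    obtain ⟨u, hu, h⟩ := this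
    exact ⟨u, h, hu⟩
  · intro u hu hl
    exact Nat.sInf_mem hne u hl hu

theorem occursAt_iff {u w : Word} {i : ℕ} :
    OccursAt u w i ↔ ∃ p q, w = p ++ u ++ q ∧ p.length = i := by
  constructor
  · rintro ⟨h, h'⟩
    refine ⟨w.take i, (w.drop i).drop u.length, ?_, by simp; omega⟩
    conv_rhs => rw [List.append_assoc]; arg 2; arg 1; rw [← h']
    rw [List.take_append_drop, List.take_append_drop]
  · rintro ⟨p, q, rfl, rfl⟩
    constructor
    · simp
    · simp

theorem occursOnce_iff_of_suffix {s w : Word} (h : s <:+ w) :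
    OccursOnce s w ↔ s ∉ repeatedSuffixes w := by
  have h0 : OccursAt s w (w.length - s.length) := by
    obtain ⟨t, rfl⟩ := h
    exact occursAt_iff.2 ⟨t, [], by simp, by simp⟩
  constructor
  · rintro hu ⟨-, y, p, q, hw⟩
    have h1 : OccursAt s w p.length := occursAt_iff.2 ⟨p, y :: q, by simp [← hw], rfl⟩
    have h2 := hu.unique h0 h1
    have h3 := congrArg List.length hw
    simp at h3
    omega
  · intro hs
    refine ⟨_, h0, fun i hi => ?_⟩
    obtain ⟨p, q, rfl, rfl⟩ := occursAt_iff.1 hi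
    cases q with
    | nil => simp
    | cons y q => exact absurd ⟨h, y, p, q, by simp⟩ hs

theorem length_image_repeatedSuffixes (w : Word) :
    List.length '' repeatedSuffixes w = Set.Iio (Kp w) := by
  have hmem : w.length ∈
      {n | ∃ s : Word, s <:+ w ∧ s.length = n ∧ OccursOnce s w} := by
    refine ⟨w, List.suffix_refl w, rfl, (occursOnce_iff_of_suffix (List.suffix_refl w)).2 ?_⟩
    rintro ⟨-, y, h⟩
    have := h.length_le
    simp at this
  refine length_image_eq_Iio ?_ ?_ ?_
  · rintro s ⟨hs, y, hy⟩ t ht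
    refine ⟨ht.trans hs, y, ?_⟩
    obtain ⟨r, rfl⟩ := ht
    exact List.IsInfix.trans ⟨r, [], by simp⟩ hy
  · intro n hn
    have hle : Kp w ≤ w.length := Nat.sInf_le hmem
    have h := Nat.notMem_of_lt_sInf hn
    have hl : (w.drop (w.length - n)).length = n := by simp; omega
    refine ⟨w.drop (w.length - n), ?_, hl⟩
    by_contra hc
    exact h ⟨_, List.drop_suffix _ _, hl, (occursOnce_iff_of_suffix (List.drop_suffix _ _)).2 hc⟩
  · intro u hu hl
    obtain ⟨s, hs, hsl, ho⟩ := Nat.sInf_mem ⟨_, hmem⟩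
    have : u = s := (List.suffix_of_suffix_length_le hu.1 hs (by rw [hl, hsl]; rfl)).eq_of_length
      (by rw [hl, hsl]; rfl)
    subst this
    exact (occursOnce_iff_of_suffix hs).1 ho hu

theorem ncard_repeatedSuffixes (w : Word) : (repeatedSuffixes w).ncard = Kp w := by
  have hinj : Set.InjOn List.length (repeatedSuffixes w) := fun s hs t ht h =>
    (List.suffix_of_suffix_length_le hs.1 ht.1 h.le).eq_of_length h
  rw [← hinj.ncard_image, length_image_repeatedSuffixes]
  simp [Set.ncard_eq_toFinset_card']

theorem isTrapezoidal_iff_injOn (w : Word) :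
    IsTrapezoidal w ↔ Set.InjOn List.length (rightSpecials w) := by
  rw [← Set.ncard_image_iff (finite_rightSpecials w), length_image_rightSpecials]
  have h := ncard_rightSpecials_add_ncard_repeatedSuffixes w
  rw [ncard_repeatedSuffixes] at h
  have h' : (Set.Iio (Rp w)).ncard = Rp w := by simp [Set.ncard_eq_toFinset_card']
  rw [h', IsTrapezoidal]
  omega

theorem hasFullExtension_of_ne {w u v : Word} (hu : u ∈ rightSpecials w)
    (hv : v ∈ rightSpecials w) (hl : u.length = v.length) (hne : u ≠ v) :
    HasFullExtension w := by
  induction u generalizing v with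
  | nil => exact absurd (List.length_eq_zero_iff.1 hl.symm).symm hne
  | cons x u ih =>
    cases v with
    | nil => simp at hl
    | cons y v =>
      rw [mem_rightSpecials_iff] at hu hv
      by_cases huv : u = v
      · subst huv
        have hxy : x ≠ y := by rintro rfl; exact hne rfl
        refine ⟨u, fun s t => ?_⟩
        by_cases hs : s = x
        · rw [hs]; exact hu t
        · rw [AB.eq_of_ne_of_ne hs hxy.symm]; exact hv t
      · refine ih (v := v) ?_ ?_ (by simpa using hl) huv
        · exact mem_rightSpecials_iff.2 fun t => (List.suffix_cons x _).isInfix.trans (hu t)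
        · exact mem_rightSpecials_iff.2 fun t => (List.suffix_cons y _).isInfix.trans (hv t)

theorem isTrapezoidal_iff_not_hasFullExtension (w : Word) :
    IsTrapezoidal w ↔ ¬ HasFullExtension w := by
  rw [isTrapezoidal_iff_injOn]
  constructor
  · rintro h ⟨z, hz⟩
    have ha : a :: z ∈ rightSpecials w := mem_rightSpecials_iff.2 (hz a)
    have hb : b :: z ∈ rightSpecials w := mem_rightSpecials_iff.2 (hz b)
    simpa using h ha hb (by simp)
  · intro h u hu v hv hl
    by_contra hne
    exact h (hasFullExtension_of_ne hu hv hl hne)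

/-! ### The desubstitution step -/

/-- The palindromization step `w ↦ φ(w) c`, where `φ` fixes the letter `c` and maps the other
letter `d` to `c d`. -/
def psi (c : AB) : Word → Word
  | [] => [c]
  | s :: w => c :: (if s = c then psi c w else s :: psi c w)

@[simp] theorem psi_nil (c : AB) : psi c [] = [c] := rfl

@[simp] theorem psi_cons_self (c : AB) (w : Word) : psi c (c :: w) = c :: psi c w := by
  simp [psi]

theorem psi_cons_of_ne {c s : AB} (h : s ≠ c) (w : Word) :
    psi c (s :: w) = c :: s :: psi c w := by
  simp [psi, h]

theorem exists_psi_cons (c s : AB) (w : Word) : ∃ p, psi c (s :: w) = p ++ s :: psi c w := by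
  by_cases h : s = c
  · subst h
    exact ⟨[], by simp⟩
  · exact ⟨[c], by simp [psi_cons_of_ne h]⟩

theorem exists_psi_eq_cons (c : AB) (w : Word) : ∃ t, psi c w = c :: t := by
  cases w with
  | nil => exact ⟨[], rfl⟩
  | cons s w => exact ⟨_, rfl⟩

theorem length_lt_length_psi (c : AB) (w : Word) : w.length < (psi c w).length := by
  induction w with
  | nil => simp
  | cons s w ih =>
    by_cases h : s = c
    · subst h
      simpa using ih
    · simp [psi_cons_of_ne h]
      omega

theorem psi_injective (c : AB) : Function.Injective (psi c) := by
  intro u v h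
  induction u generalizing v with
  | nil =>
    have h' := congrArg List.length h
    have := length_lt_length_psi c v
    simp at h'
    exact (List.length_eq_zero_iff.1 (by omega)).symm
  | cons s u ih =>
    cases v with
    | nil =>
      have h' := congrArg List.length h
      have := length_lt_length_psi c (s :: u)
      simp at h' this
      omega
    | cons t v =>
      obtain ⟨u', hu'⟩ := exists_psi_eq_cons c u
      obtain ⟨v', hv'⟩ := exists_psi_eq_cons c v
      by_cases hs : s = c <;> by_cases ht : t = c
      · subst hs ht
        simp at h
        rw [ih h]
      · subst hs
        simp [psi_cons_of_ne ht, hu'] at h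
        exact absurd h.1.symm ht
      · subst ht
        simp [psi_cons_of_ne hs, hv'] at h
        exact absurd h.1 hs
      · simp [psi_cons_of_ne hs, psi_cons_of_ne ht] at h
        rw [h.1, ih h.2]

theorem psi_append_pair_append {x y : AB} (c : AB) (h : x ≠ y) (u v : Word) :
    psi c (u ++ x :: y :: v) = psi c u ++ x :: y :: psi c v := by
  induction u with
  | nil =>
    by_cases hx : x = c
    · subst hx
      simp [psi_cons_of_ne h.symm]
    · have hy : y = c := by
        by_contra hy
        exact h (AB.eq_of_ne_of_ne hx hy)
      subst hy
      simp [psi_cons_of_ne hx]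
  | cons s u ih =>
    by_cases hs : s = c
    · subst hs
      simp [ih]
    · simp [psi_cons_of_ne hs, ih]

theorem psi_concat_self (c : AB) (u : Word) : psi c (u ++ [c]) = psi c u ++ [c] := by
  induction u with
  | nil => simp
  | cons s u ih =>
    by_cases hs : s = c
    · subst hs
      simp [ih]
    · simp [psi_cons_of_ne hs, ih]

theorem psi_concat_of_ne {c s : AB} (h : s ≠ c) (u : Word) :
    psi c (u ++ [s]) = psi c u ++ [s, c] := by
  induction u with
  | nil => simp [psi_cons_of_ne h]
  | cons t u ih =>
    by_cases ht : t = c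
    · subst ht
      simp [ih]
    · simp [psi_cons_of_ne ht, ih]

theorem psi_replicate_self (c : AB) (n : ℕ) :
    psi c (List.replicate n c) = List.replicate (n + 1) c := by
  induction n with
  | zero => rfl
  | succ n ih => rw [List.replicate_succ, psi_cons_self, ih, ← List.replicate_succ]

theorem concat_prefix_psi {z q : Word} {t : AB} (c : AB) (h : z ++ [t] <+: q) :
    psi c z ++ [t] <+: psi c q := by
  induction z generalizing q with
  | nil =>
    obtain ⟨r, rfl⟩ := h
    by_cases ht : t = c
    · subst ht
      obtain ⟨r', hr⟩ := exists_psi_eq_cons t r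
      simp [hr]
    · simp [psi_cons_of_ne ht]
  | cons s z ih =>
    cases q with
    | nil => simp at h
    | cons s' q =>
      simp only [List.cons_append, List.cons_prefix_cons] at h
      obtain ⟨rfl, h⟩ := h
      by_cases hs : s = c
      · subst hs
        simpa using ih h
      · simpa [psi_cons_of_ne hs] using ih h

theorem concat_prefix_psi_concat {z q : Word} {t y : AB} (c : AB)
    (h : z ++ [t] <+: q ++ [y]) : psi c z ++ [t] <+: psi c q ++ [y] := by
  rcases List.prefix_concat_iff.1 h with h | h
  · obtain ⟨rfl, ht⟩ := List.append_inj' h rfl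
    rw [ht]
  · exact (concat_prefix_psi c h).trans (List.prefix_append _ _)

theorem infix_psi_concat {z q : Word} {s t y : AB} (c : AB)
    (h : s :: (z ++ [t]) <:+: q ++ [y]) : s :: (psi c z ++ [t]) <:+: psi c q ++ [y] := by
  induction q with
  | nil =>
    have := h.length_le
    simp at this
  | cons d q ih =>
    obtain ⟨p, hp⟩ := exists_psi_cons c d q
    rw [List.cons_append, List.infix_cons_iff] at h
    rw [hp, List.append_assoc]
    rcases h with h | h
    · obtain ⟨rfl, hz⟩ := List.cons_prefix_cons.1 h
      refine List.IsInfix.trans (List.IsPrefix.isInfix ?_) (List.suffix_append p _).isInfix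
      exact List.cons_prefix_cons.2 ⟨rfl, concat_prefix_psi_concat c hz⟩
    · refine (ih h).trans ⟨p ++ [d], [], by simp⟩

theorem infix_cons_psi_concat {z q : Word} {s t x y : AB} (c : AB)
    (h : s :: (z ++ [t]) <:+: x :: (q ++ [y])) :
    s :: (psi c z ++ [t]) <:+: x :: (psi c q ++ [y]) := by
  rw [List.infix_cons_iff] at h ⊢
  rcases h with h | h
  · obtain ⟨rfl, hz⟩ := List.cons_prefix_cons.1 h
    exact Or.inl (List.cons_prefix_cons.2 ⟨rfl, concat_prefix_psi_concat c hz⟩)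
  · exact Or.inr (infix_psi_concat c h)

theorem cons_psi_concat_infix_psi (c x y : AB) (w : Word) :
    x :: (psi c w ++ [y]) <:+: psi c (x :: (w ++ [y])) := by
  obtain ⟨p, hp⟩ := exists_psi_cons c x (w ++ [y])
  rw [hp]
  by_cases hy : y = c
  · subst hy
    exact ⟨p, [], by simp [psi_concat_self]⟩
  · exact ⟨p, [c], by simp [psi_concat_of_ne hy]⟩

theorem prefix_of_psi_concat_prefix_psi {c t : AB} {z q : Word} (h : psi c z ++ [t] <+: psi c q) :
    z ++ [t] <+: q := by
  induction z generalizing q with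
  | nil =>
    cases q with
    | nil => simpa using h.length_le
    | cons s q =>
      by_cases hs : s = c
      · subst hs
        obtain ⟨r, hr⟩ := exists_psi_eq_cons s q
        simpa [hr] using h
      · simpa [psi_cons_of_ne hs] using h
  | cons d z ih =>
    obtain ⟨z', hz'⟩ := exists_psi_eq_cons c z
    cases q with
    | nil =>
      have h1 := h.length_le
      have h2 := length_lt_length_psi c (d :: z)
      simp only [List.length_append, List.length_cons, List.length_nil, psi_nil] at h1 h2
      omega
    | cons s q =>
      obtain ⟨q', hq'⟩ := exists_psi_eq_cons c q
      by_cases hd : d = c <;> by_cases hs : s = c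
      · subst hd hs
        simpa using ih (by simpa using h)
      · subst hd
        simp [psi_cons_of_ne hs, hz'] at h
        exact absurd h.1.symm hs
      · subst hs
        simp [psi_cons_of_ne hd, hq'] at h
        exact absurd h.1 hd
      · simp only [psi_cons_of_ne hd, psi_cons_of_ne hs, List.cons_append,
          List.cons_prefix_cons, true_and] at h
        obtain ⟨rfl, h⟩ := h
        simpa using ih h

/-- An occurrence in `psi c w` of a letter other than `c`, or of a letter followed by `c`, comes
from a letter of `w`. -/
theorem exists_suffix_of_infix_psi {c s : AB} {Y w : Word}
    (hY : s ≠ c ∨ ∃ Y', Y = c :: Y') (h : s :: Y <:+: psi c w) :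
    ∃ q, s :: q <:+ w ∧ Y <+: psi c q := by
  have key (v : Word) (h : s :: Y <+: psi c v) (hs : s = c) :
      ∃ q, s :: q <:+ v ∧ Y <+: psi c q := by
    obtain ⟨Y', rfl⟩ := hY.resolve_left (not_not.2 hs)
    subst hs
    cases v with
    | nil => simpa using h.length_le
    | cons d v =>
      by_cases hd : d = s
      · subst hd
        exact ⟨v, List.suffix_refl _, by simpa using h⟩
      · simp [psi_cons_of_ne hd] at h
        exact absurd h.1.symm hd
  induction w with
  | nil =>
    rcases hY with hs | ⟨Y', rfl⟩
    · obtain ⟨p, q, h⟩ := h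
      have : s ∈ psi c [] := by rw [← h]; simp
      simp at this
      exact absurd this hs
    · simpa using h.length_le
  | cons d w ih =>
    have lift (h : ∃ q, s :: q <:+ w ∧ Y <+: psi c q) :
        ∃ q, s :: q <:+ d :: w ∧ Y <+: psi c q := by
      obtain ⟨q, hq, hq'⟩ := h
      exact ⟨q, hq.trans (List.suffix_cons d w), hq'⟩
    by_cases hd : d = c
    · subst hd
      rw [psi_cons_self, List.infix_cons_iff] at h
      rcases h with h | h
      · obtain ⟨rfl, hY⟩ := List.cons_prefix_cons.1 h
        exact ⟨w, List.suffix_refl _, hY⟩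
      · exact lift (ih h)
    · rw [psi_cons_of_ne hd, List.infix_cons_iff, List.infix_cons_iff] at h
      rcases h with h | h | h
      · refine key _ ?_ (List.cons_prefix_cons.1 h).1
        rwa [psi_cons_of_ne hd]
      · obtain ⟨rfl, hY⟩ := List.cons_prefix_cons.1 h
        exact ⟨w, List.suffix_refl _, hY⟩
      · exact lift (ih h)

theorem infix_of_psi_infix_psi {c s t : AB} {z w : Word}
    (h : s :: (psi c z ++ [t]) <:+: psi c w) : s :: (z ++ [t]) <:+: w := by
  obtain ⟨z', hz'⟩ := exists_psi_eq_cons c z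
  obtain ⟨q, hq, hq'⟩ := exists_suffix_of_infix_psi (Or.inr ⟨z' ++ [t], by simp [hz']⟩) h
  refine List.IsInfix.trans (List.IsPrefix.isInfix ?_) hq.isInfix
  exact List.cons_prefix_cons.2 ⟨rfl, prefix_of_psi_concat_prefix_psi hq'⟩

theorem exists_eq_psi_of_prefix_psi {c d : AB} (hd : d ≠ c) {Z q : Word}
    (h : Z ++ [d] <+: psi c q) : ∃ z, Z = psi c z := by
  induction q generalizing Z with
  | nil =>
    rcases Z with _ | ⟨e, Z⟩
    · simp at h
      exact absurd h hd
    · simpa using h.length_le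
  | cons s q ih =>
    rcases Z with _ | ⟨e, Z⟩
    · simp [psi] at h
      exact absurd h hd
    · by_cases hs : s = c
      · subst hs
        simp only [psi_cons_self, List.cons_append, List.cons_prefix_cons] at h
        obtain ⟨rfl, h⟩ := h
        obtain ⟨z, rfl⟩ := ih h
        exact ⟨e :: z, by simp⟩
      · rw [psi_cons_of_ne hs, List.cons_append, List.cons_prefix_cons] at h
        obtain ⟨rfl, h⟩ := h
        rcases Z with _ | ⟨f, Z⟩
        · exact ⟨[], rfl⟩
        · rw [List.cons_append, List.cons_prefix_cons] at h
          obtain ⟨rfl, h⟩ := h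
          obtain ⟨z, rfl⟩ := ih h
          exact ⟨f :: z, by simp [psi_cons_of_ne hs]⟩

theorem hasFullExtension_psi (c x y : AB) (w : Word) :
    HasFullExtension (x :: (psi c w ++ [y])) ↔ HasFullExtension (x :: (w ++ [y])) := by
  constructor
  · rintro ⟨Z, hZ⟩
    have hZ' (s t : AB) := (hZ s t).trans (cons_psi_concat_infix_psi c x y w)
    obtain ⟨d, hd⟩ : ∃ d, d ≠ c := by cases c; exacts [⟨b, by simp⟩, ⟨a, by simp⟩]
    obtain ⟨q, -, hq⟩ := exists_suffix_of_infix_psi (Or.inl hd) (hZ' d d)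
    obtain ⟨z, rfl⟩ := exists_eq_psi_of_prefix_psi hd hq
    exact ⟨z, fun s t => infix_of_psi_infix_psi (hZ' s t)⟩
  · rintro ⟨z, hz⟩
    exact ⟨psi c z, fun s t => infix_cons_psi_concat c (hz s t)⟩

/-! ### Central words and desubstitution -/

/-- The words obtained from the empty word by iterating the maps `psi c`. -/
inductive IsIteratedPsi : Word → Prop
  | nil : IsIteratedPsi []
  | psi (c : AB) {w : Word} : IsIteratedPsi w → IsIteratedPsi (psi c w)

theorem isIteratedPsi_replicate (c : AB) (n : ℕ) : IsIteratedPsi (List.replicate n c) := by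
  induction n with
  | zero => exact .nil
  | succ n ih => rw [← psi_replicate_self]; exact ih.psi c

theorem isCentral_replicate (c : AB) (n : ℕ) : IsCentral (List.replicate n c) := by
  cases c
  · exact Or.inl ⟨n, rfl⟩
  · exact Or.inr (Or.inl ⟨n, rfl⟩)

theorem isCentral_of_swap {x y : AB} (hxy : x ≠ y) {u v : Word}
    (h : u ++ x :: y :: v = v ++ y :: x :: u) : IsCentral (u ++ x :: y :: v) := by
  right; right
  cases x <;> cases y
  · exact absurd rfl hxy
  · exact ⟨u, v, by simp, by simpa using h⟩
  · exact ⟨v, u, by simpa using h, by simp⟩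
  · exact absurd rfl hxy

theorem psi_replicate_append_pair {x y : AB} (hxy : x ≠ y) (n : ℕ) :
    psi y (List.replicate n x) ++ [x, y] = psi y (List.replicate (n + 1) x) := by
  rw [List.replicate_succ', psi_concat_of_ne hxy]

theorem isCentral_psi_replicate {x y : AB} (hxy : x ≠ y) (n : ℕ) :
    IsCentral (psi y (List.replicate n x)) := by
  cases n with
  | zero => exact isCentral_replicate y 1
  | succ n =>
    rw [← psi_replicate_append_pair hxy]
    refine isCentral_of_swap hxy ?_
    rw [psi_replicate_append_pair hxy, List.replicate_succ, psi_cons_of_ne hxy]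
    rfl

theorem isCentral_psi {w : Word} (c : AB) (h : IsCentral w) : IsCentral (psi c w) := by
  have hrep (d : AB) (n : ℕ) : IsCentral (psi c (List.replicate n d)) := by
    by_cases hd : d = c
    · subst hd
      rw [psi_replicate_self]
      exact isCentral_replicate d _
    · exact isCentral_psi_replicate hd n
  rcases h with ⟨n, rfl⟩ | ⟨n, rfl⟩ | ⟨u, v, hu, hv⟩
  · exact hrep a n
  · exact hrep b n
  · have hab : a ≠ b := by simp
    simp only [List.append_assoc, List.cons_append, List.nil_append] at hu hv
    have h1 := congrArg (psi c) (hu.symm.trans hv)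
    rw [psi_append_pair_append c hab, psi_append_pair_append c hab.symm] at h1
    rw [hu, psi_append_pair_append c hab]
    exact isCentral_of_swap hab h1

theorem IsIteratedPsi.isCentral {w : Word} (h : IsIteratedPsi w) : IsCentral w := by
  induction h with
  | nil => exact isCentral_replicate a 0
  | psi c _ ih => exact isCentral_psi c ih

theorem exists_eq_psi_replicate {x y : AB} (hxy : x ≠ y) {v : Word}
    (h : x :: y :: v = v ++ [y, x]) : ∃ n, v = psi x (List.replicate n y) := by
  induction hn : v.length using Nat.strong_induction_on generalizing v with
  | _ n ih =>
    match v, h with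
    | [], h => simp at h; exact absurd h.1 hxy
    | [d], h => simp at h; exact ⟨0, by rw [← h.1]; rfl⟩
    | d :: e :: t, h =>
      simp only [List.cons_append, List.cons.injEq] at h
      obtain ⟨rfl, rfl, h⟩ := h
      obtain ⟨k, rfl⟩ := ih t.length (by simp at hn; omega) h rfl
      exact ⟨k + 1, by rw [List.replicate_succ, psi_cons_of_ne hxy.symm]⟩

theorem eq_replicate_of_concat_eq_cons {x : AB} {u : Word} (h : x :: u = u ++ [x]) :
    u = List.replicate u.length x := by
  induction u with
  | nil => rfl
  | cons d u ih =>
    simp only [List.cons_append, List.cons.injEq] at h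
    obtain ⟨rfl, h⟩ := h
    rw [List.length_cons, List.replicate_succ, ← ih h]

theorem exists_psi_of_swap {x y : AB} (hxy : x ≠ y) {u v : Word}
    (h : u ++ x :: y :: v = v ++ y :: x :: u) :
    u = [] ∨ v = [] ∨ ∃ c u' v', u = psi c u' ∧ v = psi c v' := by
  induction hn : u.length + v.length using Nat.strong_induction_on generalizing u v x y with
  | _ n ih =>
    wlog hle : u.length ≤ v.length generalizing u v x y
    · rcases this hxy.symm h.symm (by omega) (by omega) with h | h | ⟨c, u', v', h, h'⟩
      · exact Or.inr (Or.inl h)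
      · exact Or.inl h
      · exact Or.inr (Or.inr ⟨c, v', u', h', h⟩)
    by_cases hu : u = []
    · exact Or.inl hu
    right; right
    obtain ⟨r, rfl⟩ := List.prefix_of_prefix_length_le (List.prefix_append u (x :: y :: v))
      (h ▸ List.prefix_append v _) hle
    rw [List.append_assoc, List.append_cancel_left_eq] at h
    match r, h with
    | [], h => simp at h; exact absurd h.1 hxy
    | [d], h =>
      simp only [List.cons_append, List.nil_append, List.cons.injEq, true_and] at h
      obtain ⟨rfl, h⟩ := h
      have hrep := eq_replicate_of_concat_eq_cons h.symm
      obtain ⟨m, hm⟩ : ∃ m, u.length = m + 1 :=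
        ⟨u.length - 1, by have := List.length_pos_iff.2 hu; omega⟩
      rw [hm] at hrep
      refine ⟨x, List.replicate m x, List.replicate (m + 1) x, ?_, ?_⟩
      · rw [psi_replicate_self, hrep]
      · rw [psi_replicate_self, hrep, List.replicate_succ' (n := m + 1)]
    | d :: e :: t, h =>
      simp only [List.cons_append, List.cons.injEq] at h
      obtain ⟨rfl, rfl, h⟩ := h
      rcases ih (u.length + t.length) (by simp at hn; omega) hxy h rfl with
        h0 | rfl | ⟨c, u', t', rfl, rfl⟩
      · exact absurd h0 hu
      · obtain ⟨k, rfl⟩ := exists_eq_psi_replicate hxy.symm (by simpa using h.symm)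
        exact ⟨_, _, _, rfl, psi_replicate_append_pair hxy k⟩
      · exact ⟨c, u', _, rfl, (psi_append_pair_append c hxy u' t').symm⟩

theorem IsCentral.isIteratedPsi {w : Word} (h : IsCentral w) : IsIteratedPsi w := by
  induction hn : w.length using Nat.strong_induction_on generalizing w with
  | _ n ih =>
    have hab : a ≠ b := by simp
    rcases h with ⟨n, rfl⟩ | ⟨n, rfl⟩ | ⟨u, v, hu, hv⟩
    · exact isIteratedPsi_replicate a n
    · exact isIteratedPsi_replicate b n
    · simp only [List.append_assoc, List.cons_append, List.nil_append] at hu hv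
      have huv := hu.symm.trans hv
      rcases exists_psi_of_swap hab huv with rfl | rfl | ⟨c, u', v', rfl, rfl⟩
      · obtain ⟨k, rfl⟩ := exists_eq_psi_replicate hab (by simpa using huv)
        rw [hv, psi_replicate_append_pair hab.symm]
        exact (isIteratedPsi_replicate b _).psi a
      · obtain ⟨k, rfl⟩ := exists_eq_psi_replicate hab.symm (by simpa using huv.symm)
        rw [hu, psi_replicate_append_pair hab]
        exact (isIteratedPsi_replicate a _).psi b
      · have huv' := huv
        rw [← psi_append_pair_append c hab, ← psi_append_pair_append c hab.symm] at huv'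
        have hc := isCentral_of_swap hab (psi_injective c huv')
        rw [← psi_append_pair_append c hab] at hu
        rw [hu]
        refine (ih _ ?_ hc rfl).psi c
        rw [← hn, hu]
        exact length_lt_length_psi c _

theorem isCentral_iff_isIteratedPsi {w : Word} : IsCentral w ↔ IsIteratedPsi w :=
  ⟨IsCentral.isIteratedPsi, IsIteratedPsi.isCentral⟩

/-! ### Strictly bispecial words -/

/-- None of the two-sided extensions of `w` by a letter has a full extension. -/
def IsStrictlyBispecial (w : Word) : Prop := ∀ x y, ¬ HasFullExtension (x :: (w ++ [y]))

theorem isStrictlyBispecial_psi (c : AB) (w : Word) :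
    IsStrictlyBispecial (psi c w) ↔ IsStrictlyBispecial w := by
  simp only [IsStrictlyBispecial, hasFullExtension_psi]

theorem isStrictlyBispecial_nil : IsStrictlyBispecial [] := by
  rintro x y ⟨z, hz⟩
  have key (s t : AB) : s :: (z ++ [t]) = x :: ([] ++ [y]) :=
    (hz s t).eq_of_length_le (by simp)
  have h1 := key a a
  rw [← key b a] at h1
  simp at h1

theorem isStrictlyBispecial_pair {x y : AB} (hxy : x ≠ y) : IsStrictlyBispecial [x, y] := by
  rintro p q ⟨z, hz⟩
  have haa := hz a a
  have hab := hz a b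
  have hba := hz b a
  have hbb := hz b b
  rcases z with _ | ⟨c, _ | ⟨d, _ | ⟨e, z⟩⟩⟩
  · cases p <;> cases q <;> cases x <;> cases y <;> revert haa hab hba hbb hxy <;> decide
  · cases p <;> cases q <;> cases x <;> cases y <;> cases c <;>
      revert haa hab hba hbb hxy <;> decide
  · have h1 := haa.eq_of_length_le (by simp)
    rw [← hba.eq_of_length_le (by simp)] at h1
    simp at h1
  · have := haa.length_le
    simp at this
    omega

theorem isStrictlyBispecial_of_isIteratedPsi {w : Word} (h : IsIteratedPsi w) :
    IsStrictlyBispecial w := by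
  induction h with
  | nil => exact isStrictlyBispecial_nil
  | psi c _ ih => exact (isStrictlyBispecial_psi c _).2 ih

theorem isStrictlyBispecial_append_pair_append {x y : AB} (hxy : x ≠ y) {u : Word}
    (h : IsIteratedPsi u) : IsStrictlyBispecial (u ++ x :: y :: u) := by
  induction h with
  | nil => exact isStrictlyBispecial_pair hxy
  | psi c _ ih =>
    rw [← psi_append_pair_append c hxy]
    exact (isStrictlyBispecial_psi c _).2 ih

theorem pair_infix_cons_of_mem {c d : AB} (hdc : d ≠ c) {l : Word} (h : d ∈ l) :
    [c, d] <:+: c :: l := by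
  induction l with
  | nil => simp at h
  | cons e l ih =>
    by_cases he : e = d
    · subst he
      exact ⟨[], l, rfl⟩
    · have hec : e = c := by
        by_contra hec
        exact he (AB.eq_of_ne_of_ne hec hdc)
      subst hec
      have hl : d ∈ l := (List.mem_cons.1 h).resolve_left hdc
      exact (ih hl).trans (List.suffix_cons _ _).isInfix

theorem pair_infix_concat_of_mem {c d : AB} (hdc : d ≠ c) {l : Word} (h : d ∈ l) :
    [d, c] <:+: l ++ [c] := by
  have := pair_infix_cons_of_mem hdc (List.mem_reverse.2 h)
  simpa using List.reverse_infix.2 this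

theorem hasFullExtension_of_pairs {c d : AB} (hdc : d ≠ c) {w : Word} (h1 : [c, c] <:+: w)
    (h2 : [c, d] <:+: w) (h3 : [d, c] <:+: w) (h4 : [d, d] <:+: w) : HasFullExtension w := by
  have hor (s : AB) : s = c ∨ s = d :=
    or_iff_not_imp_left.2 fun hs => AB.eq_of_ne_of_ne hs hdc
  refine ⟨[], fun s t => ?_⟩
  rcases hor s with rfl | rfl <;> rcases hor t with rfl | rfl <;> assumption

theorem exists_eq_psi_of_not_infix_concat {c d : AB} (hdc : d ≠ c) {l : Word}
    (hl : ∀ e t, l = e :: t → e = c) (h : ¬ [d, d] <:+: l ++ [c]) :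
    ∃ v, l ++ [c] = psi c v := by
  induction hn : l.length using Nat.strong_induction_on generalizing l with
  | _ n ih =>
    match l, hl, h with
    | [], _, _ => exact ⟨[], rfl⟩
    | [e], hl, _ => exact ⟨[c], by rw [hl e [] rfl]; simp⟩
    | e :: f :: t, hl, h =>
      obtain rfl := hl e _ rfl
      by_cases hf : f = e
      · subst hf
        obtain ⟨v, hv⟩ := ih (f :: t).length (by simp at hn ⊢; omega)
          (by rintro _ _ ⟨⟩; rfl) (fun h' => h (h'.trans (List.suffix_cons _ _).isInfix)) rfl
        exact ⟨f :: v, by rw [psi_cons_self, ← hv]; rfl⟩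
      · have hfd := AB.eq_of_ne_of_ne hf hdc
        subst hfd
        have ht : ∀ g t', t = g :: t' → g = e := by
          rintro g t' rfl
          by_contra hg
          rw [AB.eq_of_ne_of_ne hg hf] at h
          exact h ⟨[e], t' ++ [e], by simp⟩
        obtain ⟨v, hv⟩ := ih t.length (by simp at hn; omega) ht
          (fun h' => h (h'.trans ⟨[e, f], [], by simp⟩)) rfl
        exact ⟨f :: v, by rw [psi_cons_of_ne hf, ← hv]; rfl⟩

theorem IsStrictlyBispecial.eq_psi_or {w : Word} (h : IsStrictlyBispecial w) :
    w = [] ∨ (∃ x y, x ≠ y ∧ w = [x, y]) ∨ ∃ c v, w = psi c v := by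
  rcases w with _ | ⟨x, t⟩
  · exact Or.inl rfl
  right
  rcases List.eq_nil_or_concat' t with rfl | ⟨w, y, rfl⟩
  · exact Or.inr ⟨x, [], rfl⟩
  by_cases hxy : x = y
  · subst hxy
    obtain ⟨d, hd⟩ : ∃ d, d ≠ x := by cases x; exacts [⟨b, by simp⟩, ⟨a, by simp⟩]
    have hdd : ¬ [d, d] <:+: x :: w ++ [x] := by
      intro hdd
      have hmem : d ∈ x :: w ++ [x] := hdd.subset (by simp)
      have hw : d ∈ w := by simpa [hd] using hmem
      refine h x d (hasFullExtension_of_pairs hd ⟨[], w ++ [x, d], by simp⟩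
        ((pair_infix_cons_of_mem hd hw).trans ⟨[x], [x, d], by simp⟩)
        ((pair_infix_concat_of_mem hd hw).trans ⟨[x, x], [d], by simp⟩)
        (hdd.trans ⟨[x], [d], by simp⟩))
    exact Or.inr ⟨x, exists_eq_psi_of_not_infix_concat hd (by rintro _ _ ⟨⟩; rfl) hdd⟩
  · left
    have hyx : y ≠ x := Ne.symm hxy
    have hcross : [x, y] <:+: x :: (w ++ [y]) := pair_infix_cons_of_mem hyx (by simp)
    have hxx : ¬ [x, x] <:+: x :: (w ++ [y]) := fun hxx =>
      h y y (hasFullExtension_of_pairs hyx (hxx.trans ⟨[y], [y], by simp⟩)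
        (hcross.trans ⟨[y], [y], by simp⟩) ⟨[], w ++ [y, y], by simp⟩ ⟨y :: x :: w, [], by simp⟩)
    have hyy : ¬ [y, y] <:+: x :: (w ++ [y]) := fun hyy =>
      h x x (hasFullExtension_of_pairs hyx ⟨[], w ++ [y, x], by simp⟩
        (hcross.trans ⟨[x], [x], by simp⟩) ⟨x :: x :: w, [], by simp⟩
        (hyy.trans ⟨[x], [x], by simp⟩))
    have hyx' : ¬ [y, x] <:+: x :: (w ++ [y]) := fun h' =>
      h x y (hasFullExtension_of_pairs hyx ⟨[], w ++ [y, y], by simp⟩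
        (hcross.trans ⟨[x], [y], by simp⟩) (h'.trans ⟨[x], [y], by simp⟩)
        ⟨x :: x :: w, [], by simp⟩)
    refine ⟨x, y, hxy, ?_⟩
    rcases w with _ | ⟨e, w⟩
    · rfl
    exfalso
    by_cases he : e = x
    · exact hxx ⟨[], w ++ [y], by simp [he]⟩
    obtain rfl := AB.eq_of_ne_of_ne he hyx
    rcases w with _ | ⟨f, w⟩
    · exact hyy ⟨[x], [], by simp⟩
    by_cases hf : f = x
    · exact hyx' ⟨[x], w ++ [e], by simp [hf]⟩
    · exact hyy ⟨[x], w ++ [e], by simp [AB.eq_of_ne_of_ne hf hyx]⟩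

theorem IsStrictlyBispecial.isIteratedPsi_or {w : Word} (h : IsStrictlyBispecial w) :
    IsIteratedPsi w ∨ ∃ u x y, x ≠ y ∧ IsIteratedPsi u ∧ w = u ++ x :: y :: u := by
  induction hn : w.length using Nat.strong_induction_on generalizing w with
  | _ n ih =>
    rcases h.eq_psi_or with rfl | ⟨x, y, hxy, rfl⟩ | ⟨c, v, rfl⟩
    · exact Or.inl .nil
    · exact Or.inr ⟨[], x, y, hxy, .nil, rfl⟩
    · rcases ih v.length (hn ▸ length_lt_length_psi c v)
        ((isStrictlyBispecial_psi c v).1 h) rfl with hv | ⟨u, x, y, hxy, hu, rfl⟩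
      · exact Or.inl (hv.psi c)
      · exact Or.inr ⟨psi c u, x, y, hxy, hu.psi c, psi_append_pair_append c hxy u u⟩

/-- a trapezoidal word is strictly bispecial iff it is central or semicentral. -/
theorem strictly_bispecial_trapezoidal_characterization (w : Word) (htrap : IsTrapezoidal w) :
    (IsTrapezoidal (AB.a :: (w ++ [AB.a])) ∧ IsTrapezoidal (AB.a :: (w ++ [AB.b])) ∧
     IsTrapezoidal (AB.b :: (w ++ [AB.a])) ∧ IsTrapezoidal (AB.b :: (w ++ [AB.b]))) ↔
      (IsCentral w ∨ IsSemicentral w) := by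
  have hS : (IsTrapezoidal (AB.a :: (w ++ [AB.a])) ∧ IsTrapezoidal (AB.a :: (w ++ [AB.b])) ∧
      IsTrapezoidal (AB.b :: (w ++ [AB.a])) ∧ IsTrapezoidal (AB.b :: (w ++ [AB.b]))) ↔
      IsStrictlyBispecial w := by
    simp only [isTrapezoidal_iff_not_hasFullExtension]
    constructor
    · rintro ⟨haa, hab, hba, hbb⟩ x y
      cases x <;> cases y <;> assumption
    · exact fun h => ⟨h a a, h a b, h b a, h b b⟩
  rw [hS, isCentral_iff_isIteratedPsi]
  constructor
  · intro h
    refine h.isIteratedPsi_or.imp_right ?_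
    rintro ⟨u, x, y, hxy, hu, rfl⟩
    exact ⟨u, x, y, hxy, hu.isCentral, by simp⟩
  · rintro (h | ⟨u, x, y, hxy, hu, rfl⟩)
    · exact isStrictlyBispecial_of_isIteratedPsi h
    · simpa using isStrictlyBispecial_append_pair_append hxy hu.isIteratedPsi
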